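/- arXiv:1711.04747 — 2 statements merged into one kernel-verified Lean document; each statement's English description precedes it below -/
import Mathlib

section
/- For every n ≥ 0, the number of staircase tableaux of size n equals 4^n·n!. -/
open MvPolynomial Finset

noncomputable section

/-- The polynomial ring `ℚ[α,β,γ,δ,q,u]`: variables `0,1,2,3,4,5` are `α,β,γ,δ,q,u`. -/
abbrev P6 : Type := MvPolynomial (Fin 6) ℚ

/-- A staircase tableau of size `n` is an assignment, to each cell `(i,j)` with `j ≤ i`
(indices `0`-based here, rows numbered bottom to top, columns left to right), of either the
empty label (`none`) or one of the four symbols `α,β,γ,δ` (`some 0, some 1, some 2, some 3`),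
such that every diagonal cell is non-empty, the cells above an `α/γ` in its column are empty,
and the cells to the left of a `β/δ` in its row are empty.  Cells outside the staircase
(`i < j`) carry `none`. -/
def IsStaircase (n : ℕ) (T : Fin n → Fin n → Option (Fin 4)) : Prop :=
  (∀ i j : Fin n, i < j → T i j = none) ∧
  (∀ i : Fin n, T i i ≠ none) ∧
  (∀ i j i' : Fin n, j ≤ i → i < i' → (T i j = some 0 ∨ T i j = some 2) → T i' j = none) ∧
  (∀ i j j' : Fin n, j' < j → j ≤ i → (T i j = some 1 ∨ T i j = some 3) → T i j' = none)

instance IsStaircase.decPred (n : ℕ) : DecidablePred (IsStaircase n) := fun _ =>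
  @instDecidableAnd _ _ inferInstance
    (@instDecidableAnd _ _ inferInstance (@instDecidableAnd _ _ inferInstance inferInstance))

/-- The type of staircase tableaux of size `n`. -/
def StaircaseTableau (n : ℕ) : Type := {T : Fin n → Fin n → Option (Fin 4) // IsStaircase n T}

instance (n : ℕ) : Fintype (StaircaseTableau n) := Subtype.fintype _

/-- The label of the nearest non-empty cell to the right of the cell `(i,j)` in its row
(`none` if there is no such cell). -/
def nearestRight (n : ℕ) (T : Fin n → Fin n → Option (Fin 4)) (i j : Fin n) :
    Option (Fin 4) :=
  if h : (univ.filter fun j' : Fin n => j < j' ∧ T i j' ≠ none).Nonempty then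
    T i ((univ.filter fun j' : Fin n => j < j' ∧ T i j' ≠ none).min' h)
  else none

/-- The label of the nearest non-empty cell below the cell `(i,j)` in its column
(`none` if there is no such cell). -/
def nearestBelow (n : ℕ) (T : Fin n → Fin n → Option (Fin 4)) (i j : Fin n) :
    Option (Fin 4) :=
  if h : (univ.filter fun i' : Fin n => i' < i ∧ T i' j ≠ none).Nonempty then
    T ((univ.filter fun i' : Fin n => i' < i ∧ T i' j ≠ none).max' h) j
  else none

/-- The condition for an empty cell to receive a `q` in the `q/u` filling: the nearest
non-empty cell to its right contains a `δ`, or the nearest non-empty cell to its right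
contains an `α` or a `γ` and the nearest non-empty cell below it contains a `β` or a `γ`. -/
def QCell (n : ℕ) (T : Fin n → Fin n → Option (Fin 4)) (i j : Fin n) : Prop :=
  nearestRight n T i j = some 3 ∨
    ((nearestRight n T i j = some 0 ∨ nearestRight n T i j = some 2) ∧
      (nearestBelow n T i j = some 1 ∨ nearestBelow n T i j = some 2))

instance (n : ℕ) (T : Fin n → Fin n → Option (Fin 4)) (i j : Fin n) :
    Decidable (QCell n T i j) := by
  unfold QCell; infer_instance

/-- A filling `r` of a row is admissible for the set `S` of open columns if its labels lie in open
columns and every cell to the left of a `β/δ` is empty. -/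
def IsRow {m : ℕ} (S : Fin m → Prop) (r : Fin m → Option (Fin 4)) : Prop :=
  (∀ j, ¬ S j → r j = none) ∧
    ∀ j j', j' < j → (r j = some 1 ∨ r j = some 3) → r j' = none

open scoped Classical in
/-- `x` to the number of columns of `S` that remain open after adding the row `r`. -/
def rowWeight {m : ℕ} (x : ℕ) (S : Fin m → Prop) (r : Fin m → Option (Fin 4)) : ℕ :=
  ∏ j, if S j ∧ ¬ (r j = some 0 ∨ r j = some 2) then x else 1

open scoped Classical in
/-- The generating function of admissible rows by the number of columns remaining open. -/
def rowSum {m : ℕ} (x : ℕ) (S : Fin m → Prop) : ℕ :=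
  ∑ r : Fin m → Option (Fin 4), if IsRow S r then rowWeight x S r else 0

/-- The column `j` of `T` contains no `α/γ`. -/
def IsOpenColumn {n : ℕ} (T : Fin n → Fin n → Option (Fin 4)) (j : Fin n) : Prop :=
  ∀ i, ¬ (T i j = some 0 ∨ T i j = some 2)

open scoped Classical in
/-- The generating function of staircase tableaux by the number of open columns. -/
def openColumnSum (n x : ℕ) : ℕ :=
  ∑ T : Fin n → Fin n → Option (Fin 4),
    if IsStaircase n T then ∏ j, (if IsOpenColumn T j then x else 1) else 0

theorem sum_snoc {m : ℕ} {A : Type*} [Fintype A] (f : (Fin (m + 1) → A) → ℕ) :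
    ∑ r, f r = ∑ a : A, ∑ r : Fin m → A, f (Fin.snoc (α := fun _ => A) r a) := by
  rw [← (Fin.snocEquiv (fun _ : Fin (m + 1) => A)).sum_comp, Fintype.sum_prod_type]
  rfl

theorem isRow_snoc {m : ℕ} (S : Fin (m + 1) → Prop) (r : Fin m → Option (Fin 4))
    (a : Option (Fin 4)) :
    IsRow S (Fin.snoc (α := fun _ => Option (Fin 4)) r a) ↔
      IsRow (fun j => S j.castSucc) r ∧ (¬ S (Fin.last m) → a = none) ∧
        ((a = some 1 ∨ a = some 3) → r = fun _ => none) := by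
  simp only [IsRow, Fin.forall_fin_succ', Fin.snoc_castSucc, Fin.snoc_last, Fin.castSucc_lt_last,
    Fin.castSucc_lt_castSucc_iff, funext_iff, Fin.not_lt.2 (Fin.le_last _)]
  grind

open scoped Classical in
theorem rowWeight_snoc {m : ℕ} (x : ℕ) (S : Fin (m + 1) → Prop)
    (r : Fin m → Option (Fin 4)) (a : Option (Fin 4)) :
    rowWeight x S (Fin.snoc (α := fun _ => Option (Fin 4)) r a) =
      rowWeight x (fun j => S j.castSucc) r *
        if S (Fin.last m) ∧ ¬ (a = some 0 ∨ a = some 2) then x else 1 := by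
  rw [rowWeight, rowWeight, Fin.prod_univ_castSucc]
  congr 1
  · exact Finset.prod_congr rfl fun j _ => if_congr (by simp) rfl rfl
  · exact if_congr (by simp) rfl rfl

theorem isRow_none {m : ℕ} (S : Fin m → Prop) : IsRow S fun _ => none := by
  simp [IsRow]

open scoped Classical in
theorem rowWeight_none {m : ℕ} (x : ℕ) (S : Fin m → Prop) :
    rowWeight x S (fun _ => none) = ∏ j, if S j then x else 1 := by
  simp [rowWeight]

open scoped Classical in
theorem sum_isRow_and_eq_none {m : ℕ} (x y : ℕ) (S : Fin m → Prop) :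
    ∑ r : Fin m → Option (Fin 4),
      (if IsRow S r ∧ r = (fun _ => none) then rowWeight x S r * y else 0) =
      (∏ j, if S j then x else 1) * y := by
  rw [Finset.sum_eq_single (fun _ => none)]
  · simp [isRow_none, rowWeight_none]
  · intro r _ hr
    simp [hr]
  · simp

open scoped Classical in
theorem rowSum_mul {m : ℕ} (x y : ℕ) (S : Fin m → Prop) :
    ∑ r : Fin m → Option (Fin 4), (if IsRow S r then rowWeight x S r * y else 0) =
      rowSum x S * y := by
  simp [rowSum, Finset.sum_mul]

open scoped Classical in
theorem rowSum_succ_of_not {m : ℕ} (x : ℕ) (S : Fin (m + 1) → Prop) (h : ¬ S (Fin.last m)) :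
    rowSum x S = rowSum x fun j => S j.castSucc := by
  rw [rowSum, sum_snoc]
  simp [Fintype.sum_option, isRow_snoc, rowWeight_snoc, h, rowSum]

open scoped Classical in
theorem rowSum_succ_of_mem {m : ℕ} (x : ℕ) (S : Fin (m + 1) → Prop) (h : S (Fin.last m)) :
    rowSum x S = (x + 2) * rowSum x (fun j => S j.castSucc) +
      2 * (∏ j : Fin m, if S j.castSucc then x else 1) * x := by
  rw [rowSum, sum_snoc]
  simp [Fintype.sum_option, Fin.sum_univ_four, isRow_snoc, rowWeight_snoc, h, rowSum_mul,
    sum_isRow_and_eq_none]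
  rw [rowSum]
  ring

open scoped Classical in
theorem rowSum_add {m : ℕ} (x : ℕ) (S : Fin m → Prop) :
    rowSum x S + x * (∏ j, if S j then x else 1) = (1 + x) * ∏ j, if S j then x + 2 else 1 := by
  induction m with
  | zero => simp [rowSum, rowWeight, IsRow]
  | succ m ih =>
    have := ih fun j => S j.castSucc
    rw [Fin.prod_univ_castSucc, Fin.prod_univ_castSucc]
    by_cases h : S (Fin.last m)
    · rw [rowSum_succ_of_mem x S h]
      simp only [h, if_true]
      linear_combination (x + 2) * this
    · rw [rowSum_succ_of_not x S h]
      simpa [h] using this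

open scoped Classical in
/-- Rows on top of a tableau with open columns `S`: the new diagonal cell is non-empty. -/
theorem sum_topRow {m : ℕ} (x : ℕ) (S : Fin (m + 1) → Prop) (h : S (Fin.last m)) :
    ∑ r : Fin (m + 1) → Option (Fin 4),
        (if IsRow S r ∧ r (Fin.last m) ≠ none then rowWeight x S r else 0) =
      2 * (1 + x) * ∏ j : Fin m, if S j.castSucc then x + 2 else 1 := by
  rw [sum_snoc, mul_assoc, ← rowSum_add]
  simp [Fintype.sum_option, Fin.sum_univ_four, isRow_snoc, rowWeight_snoc, h,
    sum_isRow_and_eq_none]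
  rw [rowSum]
  ring

theorem isStaircase_succ_iff {n : ℕ} (T : Fin (n + 1) → Fin (n + 1) → Option (Fin 4)) :
    IsStaircase (n + 1) T ↔
      (∀ i : Fin n, T i.castSucc (Fin.last n) = none) ∧
      IsStaircase n (fun i j => T i.castSucc j.castSucc) ∧
      IsRow (Fin.snoc (α := fun _ => Prop)
        (IsOpenColumn fun i j : Fin n => T i.castSucc j.castSucc) True) (T (Fin.last n)) ∧
      T (Fin.last n) (Fin.last n) ≠ none := by
  simp only [IsStaircase, IsRow, IsOpenColumn, Fin.forall_fin_succ', Fin.snoc_castSucc,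
    Fin.snoc_last, Fin.castSucc_lt_last, Fin.castSucc_lt_castSucc_iff,
    Fin.castSucc_le_castSucc_iff, lt_irrefl, Fin.not_lt.2 (Fin.le_last _), Fin.le_last,
    Fin.last_le_iff]
  constructor
  · grind
  · rintro ⟨h1, ⟨h2, h3, h4, h5⟩, ⟨⟨h6, h7⟩, h8⟩, h9⟩
    grind

open scoped Classical in
theorem prod_isOpenColumn_succ {n : ℕ} (x : ℕ)
    (T : Fin (n + 1) → Fin (n + 1) → Option (Fin 4))
    (h : ∀ i : Fin n, T i.castSucc (Fin.last n) = none) :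
    (∏ j, if IsOpenColumn T j then x else 1) =
      rowWeight x (Fin.snoc (α := fun _ => Prop)
        (IsOpenColumn fun i j : Fin n => T i.castSucc j.castSucc) True) (T (Fin.last n)) := by
  rw [rowWeight]
  refine Finset.prod_congr rfl fun j _ => if_congr ?_ rfl rfl
  cases j using Fin.lastCases with
  | last => simp [IsOpenColumn, Fin.forall_fin_succ', h]
  | cast j => simp [IsOpenColumn, Fin.forall_fin_succ']

open scoped Classical in
theorem openColumnSum_succ (n x : ℕ) :
    openColumnSum (n + 1) x = 2 * (1 + x) * openColumnSum n (x + 2) := by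
  have key : openColumnSum (n + 1) x =
      ∑ p ∈ univ.filter fun p : (Fin n → Fin n → Option (Fin 4)) × (Fin (n + 1) → Option (Fin 4)) =>
        IsStaircase n p.1 ∧ IsRow (Fin.snoc (α := fun _ => Prop) (IsOpenColumn p.1) True) p.2 ∧
          p.2 (Fin.last n) ≠ none,
        rowWeight x (Fin.snoc (α := fun _ => Prop) (IsOpenColumn p.1) True) p.2 := by
    rw [openColumnSum, ← Finset.sum_filter]
    refine Finset.sum_nbij' (fun T => (fun i j => T i.castSucc j.castSucc, T (Fin.last n)))
      (fun p => Fin.snoc (α := fun _ => Fin (n + 1) → Option (Fin 4))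
        (fun i => Fin.snoc (α := fun _ => Option (Fin 4)) (p.1 i) none) p.2) ?_ ?_ ?_ ?_ ?_
    · intro T hT
      simp only [mem_filter, mem_univ, true_and] at hT ⊢
      exact ((isStaircase_succ_iff T).1 hT).2
    · intro p hp
      simp only [mem_filter, mem_univ, true_and] at hp ⊢
      rw [isStaircase_succ_iff]
      simpa using hp
    · intro T hT
      simp only [mem_filter, mem_univ, true_and] at hT
      have h := ((isStaircase_succ_iff T).1 hT).1
      funext i j
      cases i using Fin.lastCases with
      | last => simp
      | cast i =>
        cases j using Fin.lastCases with
        | last => simp [h]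
        | cast j => simp
    · intro p _
      simp
    · intro T hT
      simp only [mem_filter, mem_univ, true_and] at hT
      exact prod_isOpenColumn_succ x T ((isStaircase_succ_iff T).1 hT).1
  rw [key, Finset.sum_filter, Fintype.sum_prod_type, openColumnSum, Finset.mul_sum]
  refine Finset.sum_congr rfl fun T _ => ?_
  by_cases hT : IsStaircase n T
  · simp only [hT, true_and, if_true]
    rw [sum_topRow x _ (by simp)]
    simp
  · simp [hT]

theorem openColumnSum_eq (n x : ℕ) :
    openColumnSum n x = 2 ^ n * ∏ i ∈ range n, (1 + x + 2 * i) := by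
  induction n generalizing x with
  | zero => simp [openColumnSum, IsStaircase]
  | succ n ih =>
    rw [openColumnSum_succ, ih, Finset.prod_range_succ', pow_succ]
    have : ∀ i, 1 + (x + 2) + 2 * i = 1 + x + 2 * (i + 1) := fun i => by ring
    simp only [this]
    ring

/-- the number of staircase tableaux of size `n` equals `4^n n!`. -/
theorem statement14 (n : ℕ) :
    Nat.card (StaircaseTableau n) = 4 ^ n * Nat.factorial n := by
  have h : Nat.card (StaircaseTableau n) = openColumnSum n 1 := by
    rw [StaircaseTableau, Nat.card_eq_fintype_card, Fintype.card_subtype, openColumnSum]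
    simp [Finset.sum_boole]
  rw [h, openColumnSum_eq, ← Finset.prod_range_add_one_eq_factorial]
  have : ∀ i, 1 + 1 + 2 * i = 2 * (i + 1) := fun i => by ring
  simp only [this, Finset.prod_mul_distrib, Finset.prod_const, card_range]
  rw [← mul_assoc, ← mul_pow]
  norm_num
end
end

section
/- For every n ≥ 0, the number of type B staircase tableaux of size n equals 4^n·∏_{i=1}^{n−1}(2i+1). -/
open MvPolynomial Finset

noncomputable section

/-- A staircase tableau of size `2n` is fixed by the involution `ψ` when the entry of each
cell `(i,j)` equals the entry of the cell `(2n+1−j, 2n+1−i)` (in the `1`-based numbering,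
i.e. `(Fin.rev j, Fin.rev i)` here) with `α ↔ δ` and `β ↔ γ` exchanged (the exchange of
symbols is `Fin.rev` on `Fin 4`). -/
def IsTypeB (n : ℕ) (T : Fin (2 * n) → Fin (2 * n) → Option (Fin 4)) : Prop :=
  ∀ i j : Fin (2 * n), T i j = Option.map Fin.rev (T j.rev i.rev)

instance (n : ℕ) (T : Fin (2 * n) → Fin (2 * n) → Option (Fin 4)) :
    Decidable (IsTypeB n T) := by
  unfold IsTypeB; infer_instance

/-- The type of type `B` staircase tableaux of size `n`: staircase tableaux of size `2n`
fixed by the involution `ψ`. -/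
def TypeBTableau (n : ℕ) : Type := {T : StaircaseTableau (2 * n) // IsTypeB n T.1}

instance (n : ℕ) : Fintype (TypeBTableau n) := Subtype.fintype _


/-- A staircase tableau of arbitrary size `m` fixed by the involution `ψ`. -/
def IsSymmStaircase (m : ℕ) (T : Fin m → Fin m → Option (Fin 4)) : Prop :=
  IsStaircase m T ∧ ∀ i j : Fin m, T i j = Option.map Fin.rev (T j.rev i.rev)

/-- A row is free if it contains neither `β` nor `δ`. -/
def IsFreeRow {m : ℕ} (T : Fin m → Fin m → Option (Fin 4)) (i : Fin m) : Prop :=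
  ∀ j, T i j ≠ some 1 ∧ T i j ≠ some 3

/-- The column `c` only uses rows satisfying `F`, and is empty above each `α` or `γ`. -/
structure IsFilling {m : ℕ} (F : Fin m → Prop) (c : Fin m → Option (Fin 4)) : Prop where
  free : ∀ i, c i ≠ none → F i
  above : ∀ i i', i < i' → c i = some 0 ∨ c i = some 2 → c i' = none

/-- The index in `Fin (m + 2)` of the inner index `i`. -/
def mid {m : ℕ} (i : Fin m) : Fin (m + 2) := i.castSucc.succ

lemma forall_fin_mid {m : ℕ} {p : Fin (m + 2) → Prop} :
    (∀ i, p i) ↔ p 0 ∧ (∀ i, p (mid i)) ∧ p (Fin.last (m + 1)) := by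
  rw [Fin.forall_fin_succ, Fin.forall_fin_succ']; rfl

@[simp] lemma rev_mid {m : ℕ} (i : Fin m) : (mid i).rev = mid i.rev := by
  ext; simp [mid]; omega

@[simp] lemma mid_lt_mid {m : ℕ} {i j : Fin m} : mid i < mid j ↔ i < j := by simp [mid]

@[simp] lemma mid_le_mid {m : ℕ} {i j : Fin m} : mid i ≤ mid j ↔ i ≤ j := by simp [mid]

@[simp] lemma zero_lt_mid {m : ℕ} (i : Fin m) : 0 < mid i := by simp [mid]

@[simp] lemma mid_lt_last {m : ℕ} (i : Fin m) : mid i < Fin.last (m + 1) := by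
  simp [mid, Fin.lt_def]

@[simp] lemma not_last_lt {m : ℕ} (i : Fin (m + 1)) : ¬ Fin.last m < i := by
  simp [Fin.le_last]

/-- Surround `T` by a new left column, with entries `d` on the diagonal and `c` above it, and the
`ψ`-symmetric new top row. -/
def extend {m : ℕ} (T : Fin m → Fin m → Option (Fin 4)) (d : Fin 4) (c : Fin m → Option (Fin 4)) :
    Fin (m + 2) → Fin (m + 2) → Option (Fin 4) :=
  Fin.cons (Fin.cons (some d) fun _ => none)
    (Fin.snoc (α := fun _ => Fin (m + 2) → Option (Fin 4))
      (fun i => Fin.cons (c i) (Fin.snoc (α := fun _ => Option (Fin 4)) (T i) none))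
      (Fin.cons none (Fin.snoc (α := fun _ => Option (Fin 4))
        (fun j => (c j.rev).map Fin.rev) (some d.rev))))

section extend
variable {m : ℕ} (T : Fin m → Fin m → Option (Fin 4)) (d : Fin 4) (c : Fin m → Option (Fin 4))

@[simp] lemma extend_zero_zero : extend T d c 0 0 = some d := rfl

@[simp] lemma extend_zero_mid (j : Fin m) : extend T d c 0 (mid j) = none := rfl

@[simp] lemma extend_zero_last : extend T d c 0 (Fin.last (m + 1)) = none := rfl

@[simp] lemma extend_mid_zero (i : Fin m) : extend T d c (mid i) 0 = c i := by
  simp [extend, mid]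

@[simp] lemma extend_mid_mid (i j : Fin m) : extend T d c (mid i) (mid j) = T i j := by
  simp [extend, mid]

@[simp] lemma extend_mid_last (i : Fin m) :
    extend T d c (mid i) (Fin.last (m + 1)) = none := by
  simp [extend, mid, ← Fin.succ_last]

@[simp] lemma extend_last_zero : extend T d c (Fin.last (m + 1)) 0 = none := by
  simp [extend, ← Fin.succ_last]

@[simp] lemma extend_last_mid (j : Fin m) :
    extend T d c (Fin.last (m + 1)) (mid j) = (c j.rev).map Fin.rev := by
  simp [extend, mid, ← Fin.succ_last]

@[simp] lemma extend_last_last :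
    extend T d c (Fin.last (m + 1)) (Fin.last (m + 1)) = some d.rev := by
  simp [extend, ← Fin.succ_last]

end extend

lemma map_rev_eq_one_or_three {s : Option (Fin 4)} :
    (s.map Fin.rev = some 1 ∨ s.map Fin.rev = some 3) ↔ s = some 0 ∨ s = some 2 := by
  revert s; decide

lemma map_rev_eq_zero_or_two {s : Option (Fin 4)} :
    (s.map Fin.rev = some 0 ∨ s.map Fin.rev = some 2) ↔ s = some 1 ∨ s = some 3 := by
  revert s; decide

lemma isFreeRow_extend_zero {m : ℕ} (T : Fin m → Fin m → Option (Fin 4)) (d : Fin 4)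
    (c : Fin m → Option (Fin 4)) : IsFreeRow (extend T d c) 0 ↔ d = 0 ∨ d = 2 := by
  simp only [IsFreeRow, forall_fin_mid]
  simp; omega

lemma isFreeRow_extend_mid {m : ℕ} (T : Fin m → Fin m → Option (Fin 4)) (d : Fin 4)
    (c : Fin m → Option (Fin 4)) (i : Fin m) :
    IsFreeRow (extend T d c) (mid i) ↔ IsFreeRow T i ∧ c i ≠ some 1 ∧ c i ≠ some 3 := by
  simp only [IsFreeRow, forall_fin_mid]
  simp; tauto

lemma some_rev_eq_one_or_three {d : Fin 4} :
    (some d.rev = some 1 ∨ some d.rev = some 3) ↔ d = 0 ∨ d = 2 := by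
  revert d; decide

lemma isFreeRow_extend_last {m : ℕ} (T : Fin m → Fin m → Option (Fin 4)) (d : Fin 4)
    (c : Fin m → Option (Fin 4)) :
    IsFreeRow (extend T d c) (Fin.last (m + 1)) ↔
      ¬ (d = 0 ∨ d = 2) ∧ ∀ i, ¬ (c i = some 0 ∨ c i = some 2) := by
  have h : (∀ i, ¬ (c i = some 0 ∨ c i = some 2)) ↔
      ∀ i : Fin m, ¬ (c i.rev = some 0 ∨ c i.rev = some 2) :=
    (Fin.revPerm.forall_congr_right (q := fun i => ¬ (c i = some 0 ∨ c i = some 2))).symm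
  rw [h]
  simp only [IsFreeRow, forall_fin_mid, ← not_or, extend_last_mid, map_rev_eq_one_or_three,
    extend_last_last, extend_last_zero, some_rev_eq_one_or_three]
  grind

lemma isSymmStaircase_extend {m : ℕ} {T : Fin m → Fin m → Option (Fin 4)} {d : Fin 4}
    {c : Fin m → Option (Fin 4)} :
    IsSymmStaircase (m + 2) (extend T d c) ↔
      IsSymmStaircase m T ∧ (d = 0 ∨ d = 2 → ∀ i, c i = none) ∧
        IsFilling (IsFreeRow T) c := by
  constructor
  · rintro ⟨⟨h1, h2, h3, h4⟩, h5⟩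
    refine ⟨⟨⟨fun i j h => ?_, fun i => ?_, fun i j k h h' e => ?_, fun i j k h h' e => ?_⟩,
      fun i j => ?_⟩, fun h i => ?_, fun i h => ?_, fun i j h e => ?_⟩
    · simpa using h1 (mid i) (mid j) (by simpa)
    · simpa using h2 (mid i)
    · simpa using h3 (mid i) (mid j) (mid k) (by simpa) (by simpa) (by simpa)
    · simpa using h4 (mid i) (mid j) (mid k) (by simpa) (by simpa) (by simpa)
    · simpa using h5 (mid i) (mid j)
    · simpa using h3 0 0 (mid i) le_rfl (by simp) (by simpa)
    · intro j
      rw [← not_or]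
      intro e
      have hji : j ≤ i := by
        by_contra! hij
        have := h1 (mid i) (mid j) (by simpa)
        grind [extend_mid_mid]
      exact h (by simpa using h4 (mid i) (mid j) 0 (by simp) (by simpa) (by simpa))
    · simpa using h3 (mid i) 0 (mid j) (by simp) (by simpa) (by simpa)
  · rintro ⟨⟨⟨h1, h2, h3, h4⟩, h5⟩, h6, h7, h8⟩
    refine ⟨⟨?_, ?_, ?_, ?_⟩, ?_⟩
    · simp only [forall_fin_mid]
      simpa using h1
    · simp only [forall_fin_mid]
      simpa using h2
    · have h (i j) (hT : T i j = some 0 ∨ T i j = some 2) : c j.rev = none := by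
        rw [h5, map_rev_eq_zero_or_two] at hT
        by_contra hc
        exact hT.elim (h7 _ hc _).1 (h7 _ hc _).2
      simp only [forall_fin_mid]
      simp
      grind
    · have h (i j) (hT : T i j = some 1 ∨ T i j = some 3) : c i = none := by
        by_contra hc
        exact hT.elim (h7 _ hc _).1 (h7 _ hc _).2
      simp only [forall_fin_mid, extend_last_mid, map_rev_eq_one_or_three, extend_last_last,
        some_rev_eq_one_or_three]
      simp
      exact ⟨by grind, fun i j hij _ => h8 _ _ (by simpa), by grind⟩
    · simp only [forall_fin_mid]
      simp
      exact fun i => ⟨by cases c i <;> simp, h5 i⟩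

lemma IsSymmStaircase.extend_inner {m : ℕ} {T : Fin (m + 2) → Fin (m + 2) → Option (Fin 4)}
    (h : IsSymmStaircase (m + 2) T) :
    extend (fun i j => T (mid i) (mid j)) ((T 0 0).getD 0) (fun i => T (mid i) 0) = T := by
  obtain ⟨⟨h1, h2, -, -⟩, h5⟩ := h
  suffices ∀ i j, extend (fun i j => T (mid i) (mid j)) ((T 0 0).getD 0)
      (fun i => T (mid i) 0) i j = T i j from funext₂ this
  obtain ⟨d, hd⟩ := Option.ne_none_iff_exists'.1 (h2 0)
  have h0 : T (Fin.last (m + 1)) 0 = none := by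
    have := h5 (Fin.last (m + 1)) 0
    simp only [Fin.rev_zero, Fin.rev_last] at this
    revert this
    generalize T (Fin.last (m + 1)) 0 = s
    revert s; decide
  have hl : T (Fin.last (m + 1)) (Fin.last (m + 1)) = some d.rev := by
    rw [h5]; simp [hd]
  have h0l : T 0 (Fin.last (m + 1)) = none := h1 _ _ (Fin.last_pos)
  have hm (j : Fin m) : T (Fin.last (m + 1)) (mid j) = (T (mid j.rev) 0).map Fin.rev := by
    rw [h5]; simp
  simp only [forall_fin_mid]
  simp [h1, h0, h0l, hl, hm, hd]

open Classical in
/-- The contribution of a new column `c` to the weight of a tableau: a factor `x` for each inner row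
which remains free, and one for the new top row if it is free. -/
def fillingWeight {m : ℕ} (x : ℕ) (F : Fin m → Prop) (c : Fin m → Option (Fin 4)) : ℕ :=
  (∏ i, if F i ∧ c i ≠ some 1 ∧ c i ≠ some 3 then x else 1) *
    if ∀ i, ¬ (c i = some 0 ∨ c i = some 2) then x else 1

lemma isFilling_cons {m : ℕ} {F : Fin (m + 1) → Prop} {s : Option (Fin 4)}
    {c : Fin m → Option (Fin 4)} :
    IsFilling F (Fin.cons s c : Fin (m + 1) → Option (Fin 4)) ↔
      (s ≠ none → F 0) ∧ (s = some 0 ∨ s = some 2 → c = fun _ => none) ∧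
        IsFilling (fun i => F i.succ) c := by
  constructor
  · rintro ⟨h1, h2⟩
    refine ⟨by simpa using h1 0, fun h => funext fun i => ?_, fun i h => ?_, fun i j h e => ?_⟩
    · simpa using h2 0 i.succ (by simp) (by simpa)
    · exact h1 i.succ (by simpa)
    · simpa using h2 i.succ j.succ (by simpa) (by simpa)
  · rintro ⟨h1, h2, h3, h4⟩
    refine ⟨?_, ?_⟩
    · simp only [Fin.forall_fin_succ]
      simpa using ⟨h1, h3⟩
    · simp only [Fin.forall_fin_succ]
      simp only [funext_iff] at h2
      simp only [Fin.cons_zero, Fin.cons_succ, Fin.succ_lt_succ_iff]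
      grind

lemma isFilling_none {m : ℕ} (F : Fin m → Prop) : IsFilling F (fun _ => none) :=
  ⟨by simp, by simp⟩

open Classical in
lemma fillingWeight_cons {m : ℕ} (x : ℕ) (F : Fin (m + 1) → Prop) (s : Option (Fin 4))
    (c : Fin m → Option (Fin 4)) :
    fillingWeight x F (Fin.cons s c : Fin (m + 1) → Option (Fin 4)) =
      (if F 0 ∧ s ≠ some 1 ∧ s ≠ some 3 then x else 1) *
        (∏ i, if F (Fin.succ i) ∧ c i ≠ some 1 ∧ c i ≠ some 3 then x else 1) *
          if ¬ (s = some 0 ∨ s = some 2) ∧ ∀ i, ¬ (c i = some 0 ∨ c i = some 2) then x else 1 := by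
  simp only [fillingWeight, Fin.prod_univ_succ, Fin.forall_fin_succ, Fin.cons_zero, Fin.cons_succ]

open Classical in
lemma sum_fillingWeight (x : ℕ) {m : ℕ} (F : Fin m → Prop) :
    (∑ c with IsFilling F c, fillingWeight x F c) + x * ∏ i, (if F i then x else 1) =
      2 * x * ∏ i, (if F i then x + 2 else 1) := by
  induction m with
  | zero =>
    have h (c) : IsFilling F c := ⟨by simp, by simp⟩
    simp [h, fillingWeight]; ring
  | succ m ih =>
    specialize ih fun i => F i.succ
    have hcons (g : (Fin (m + 1) → Option (Fin 4)) → ℕ) :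
        ∑ c, g c = ∑ s, ∑ c : Fin m → Option (Fin 4), g (Fin.cons s c) := by
      rw [← (Fin.consEquiv fun _ => Option (Fin 4)).sum_comp, Fintype.sum_prod_type]
      rfl
    have h0 : ({c | (c = fun _ => none) ∧ IsFilling (fun i : Fin m => F i.succ) c} : Finset _) =
        {fun _ => none} := by
      ext c
      simp only [Finset.mem_filter, Finset.mem_univ, true_and, Finset.mem_singleton,
        and_iff_left_iff_imp]
      rintro rfl
      exact isFilling_none _
    rw [Finset.sum_filter, hcons, Fintype.sum_option, Fin.sum_univ_four, Fin.prod_univ_succ,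
      Fin.prod_univ_succ]
    simp only [← Finset.sum_filter, isFilling_cons, fillingWeight_cons]
    simp only [fillingWeight] at ih
    by_cases h : F 0
    · simp [h, h0, -mul_ite]
      simp only [mul_assoc, ← Finset.mul_sum]
      simp [-mul_ite] at ih
      linear_combination (x + 2) * ih
    · simp [h]
      simpa using ih

open Classical in
lemma sum_column (x : ℕ) {m : ℕ} (F : Fin m → Prop) :
    ∑ d : Fin 4, ∑ c with (d = 0 ∨ d = 2 → ∀ i, c i = none) ∧ IsFilling F c,
      (if d = 0 ∨ d = 2 then x else 1) *
        ((∏ i, if F i ∧ c i ≠ some 1 ∧ c i ≠ some 3 then x else 1) *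
          if ¬ (d = 0 ∨ d = 2) ∧ ∀ i, ¬ (c i = some 0 ∨ c i = some 2) then x else 1) =
      4 * x * ∏ i, (if F i then x + 2 else 1) := by
  have h := sum_fillingWeight x F
  have h0 : ({c | (∀ i, c i = none) ∧ IsFilling F c} : Finset (Fin m → Option (Fin 4))) =
      {fun _ => none} := by
    ext c
    simp only [Finset.mem_filter, Finset.mem_univ, true_and, Finset.mem_singleton, funext_iff]
    refine ⟨And.left, fun h => ⟨h, ?_⟩⟩
    obtain rfl : c = fun _ => none := funext h
    exact isFilling_none F
  rw [Fin.sum_univ_four]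
  simp [h0]
  simp [fillingWeight] at h
  linarith

open Classical in
/-- The generating polynomial of symmetric tableaux by number of free rows. -/
def freeRowSum (m x : ℕ) : ℕ :=
  ∑ T with IsSymmStaircase m T, ∏ i, if IsFreeRow T i then x else 1

lemma freeRowSum_add_two (m x : ℕ) : freeRowSum (m + 2) x = 4 * x * freeRowSum m (x + 2) := by
  classical
  simp only [freeRowSum, Finset.mul_sum]
  simp_rw [← sum_column]
  simp only [Finset.sum_sigma']
  symm
  refine Finset.sum_bij' (fun p _ => extend p.1 p.2.1 p.2.2)
    (fun T _ => ⟨fun i j => T (mid i) (mid j), (T 0 0).getD 0, fun i => T (mid i) 0⟩) ?_ ?_ ?_ ?_ ?_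
  · rintro ⟨T, d, c⟩ h
    simpa [isSymmStaircase_extend] using h
  · intro T h
    have h : IsSymmStaircase (m + 2) T := by simpa using h
    have h' := h
    rw [← h.extend_inner, isSymmStaircase_extend] at h'
    simpa using h'
  · rintro ⟨T, d, c⟩ h
    simp
  · intro T h
    exact IsSymmStaircase.extend_inner (by simpa using h)
  · rintro ⟨T, d, c⟩ h
    rw [Fin.prod_univ_succ, Fin.prod_univ_castSucc]
    congr 1
    · exact if_congr (isFreeRow_extend_zero T d c).symm rfl rfl
    · congr 1
      · exact Finset.prod_congr rfl fun i _ => if_congr (isFreeRow_extend_mid T d c i).symm rfl rfl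
      · exact if_congr (isFreeRow_extend_last T d c).symm rfl rfl

lemma freeRowSum_two_mul (n x : ℕ) :
    freeRowSum (2 * n) x = 4 ^ n * ∏ i ∈ Finset.range n, (x + 2 * i) := by
  induction n generalizing x with
  | zero =>
    have h (T) : IsSymmStaircase 0 T := by simp [IsSymmStaircase, IsStaircase]
    simp [freeRowSum, h]
  | succ n ih =>
    rw [mul_add, mul_one, freeRowSum_add_two, ih, Finset.prod_range_succ', pow_succ]
    simp only [mul_add, add_assoc, mul_one, add_comm 2]
    ring

lemma card_typeBTableau (n : ℕ) : Nat.card (TypeBTableau n) = freeRowSum (2 * n) 1 := by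
  refine (Nat.card_congr
    (Equiv.subtypeSubtypeEquivSubtypeInter (IsStaircase (2 * n)) (IsTypeB n))).trans ?_
  simp only [freeRowSum, ite_self, Finset.prod_const_one, Finset.sum_const, smul_eq_mul, mul_one]
  classical exact Nat.subtype_card _ fun T => Finset.mem_filter_univ T

/-- the number of type `B` staircase tableaux of size `n` equals
`4^n ∏_{i=1}^{n−1} (2i+1)`. -/
theorem statement16 (n : ℕ) :
    Nat.card (TypeBTableau n) = 4 ^ n * ∏ i ∈ Finset.Icc 1 (n - 1), (2 * i + 1) := by
  rw [card_typeBTableau, freeRowSum_two_mul]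
  cases n with
  | zero => simp
  | succ n =>
    rw [Finset.prod_range_succ', Nat.add_sub_cancel, ← Finset.Ico_add_one_right_eq_Icc,
      Finset.prod_Ico_eq_prod_range]
    simp [mul_add, add_comm]
end
end
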